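/- Let Y be a finite-rank strong subgroup of K^× and let g ∈ G be algebraic over the subfield of K generated by Y. Then g^n ∈ Y for some integer n ≥ 1. (A strong set acquires no new green points in its algebraic closure.) -/

import Mathlib

noncomputable section

namespace GreenPoints

variable {K : Type*} [Field K] [CharZero K]

/-- The rank of a (multiplicative) subgroup of `Kˣ`: the ℤ-module rank of the
underlying abelian group, i.e. the dimension over ℚ of `S ⊗ ℚ`. -/
def grpRank (S : Subgroup Kˣ) : Cardinal := Module.rank ℤ (Additive S)

/-- A subgroup of `Kˣ` has finite rank. -/
def FiniteRank (S : Subgroup Kˣ) : Prop := grpRank S < Cardinal.aleph0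

/-- The transcendence degree over ℚ of the subfield of `K` generated by a subset `s` of `K`:
the supremum of the cardinalities of subsets of `s` that are algebraically
independent over ℚ. -/
def tdSet (s : Set K) : Cardinal :=
  ⨆ t : {t : Set K // t ⊆ s ∧ AlgebraicIndependent ℚ ((↑) : t → K)}, Cardinal.mk t.1

/-- The transcendence degree over ℚ of the subfield of `K` generated by a subgroup of `Kˣ`. -/
def td (S : Subgroup Kˣ) : Cardinal := tdSet (Units.val '' (S : Set Kˣ))

/-- The predimension `δ(S) = 2·td(S) − rk(S ∩ G)` (with respect to the subgroup `G`
of green points). -/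
def delta (G S : Subgroup Kˣ) : ℤ :=
  2 * ((td S).toNat : ℤ) - ((grpRank (S ⊓ G)).toNat : ℤ)

/-- `Y` is strong in `T` (with respect to `G`): `δ(W) ≥ δ(Y)` for every finite-rank
subgroup `W` with `Y ⊆ W ⊆ T`. -/
def StrongIn (G Y T : Subgroup Kˣ) : Prop :=
  ∀ W : Subgroup Kˣ, FiniteRank W → Y ≤ W → W ≤ T → delta G Y ≤ delta G W

/-- `Y` is strong: strong in `Kˣ`. -/
def Strong (G Y : Subgroup Kˣ) : Prop := StrongIn G Y ⊤

/-- A subgroup `S` of `Kˣ` is root-closed: `x ∈ S` whenever `x^n ∈ S` for some `n ≥ 1`. -/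
def RootClosed (S : Subgroup Kˣ) : Prop :=
  ∀ (x : Kˣ) (n : ℕ), 1 ≤ n → x ^ n ∈ S → x ∈ S

/-- The subfield of `K` generated by a subgroup of `Kˣ`. -/
def fieldOf (S : Subgroup Kˣ) : Subfield K := Subfield.closure (Units.val '' (S : Set Kˣ))

theorem tdSet_eq_cRk (s : Set K) :
    tdSet s = (AlgebraicIndependent.matroid ℚ K).cRk s := by
  apply le_antisymm
  · refine ciSup_le' fun t => ?_
    exact Matroid.Indep.cardinalMk_le_cRk_of_subset
      (AlgebraicIndependent.matroid_indep_iff.2 t.2.2) t.2.1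
  · rw [Matroid.cRk_le_iff]
    intro I hI
    exact le_ciSup (f := fun t : {t : Set K // t ⊆ s ∧ AlgebraicIndependent ℚ ((↑) : t → K)} =>
      Cardinal.mk t.1) Cardinal.bddAbove_of_small
      ⟨I, hI.subset, AlgebraicIndependent.matroid_indep_iff.1 hI.indep⟩

theorem isAlgebraic_adjoin_of_closure (s : Set K) (x : K)
    (hx : IsAlgebraic (Subfield.closure s) x) : IsAlgebraic (Algebra.adjoin ℚ s) x := by
  have hle : ∀ y ∈ Subfield.closure s, y ∈ IntermediateField.adjoin ℚ s := fun y hy =>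
    (Subfield.closure_le (t := (IntermediateField.adjoin ℚ s).toSubfield)).2
      (IntermediateField.subset_adjoin ℚ s) hy
  let f : Subfield.closure s →+* IntermediateField.adjoin ℚ s :=
    { toFun := fun y => ⟨y, hle y y.2⟩
      map_one' := rfl
      map_mul' := fun _ _ => rfl
      map_zero' := rfl
      map_add' := fun _ _ => rfl }
  have h1 : IsAlgebraic (IntermediateField.adjoin ℚ s) x := by
    obtain ⟨p, hp, hpx⟩ := hx
    refine ⟨p.map f, (Polynomial.map_ne_zero_iff f.injective).2 hp, ?_⟩
    rw [Polynomial.aeval_def] at hpx ⊢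
    rw [Polynomial.eval₂_map]
    exact hpx
  exact IntermediateField.isAlgebraic_adjoin_iff.1 h1

theorem td_sup_eq (Y : Subgroup Kˣ) (g : Kˣ) (halg : IsAlgebraic (fieldOf Y) (g : K)) :
    td (Y ⊔ Subgroup.zpowers g) = td Y := by
  unfold td
  rw [tdSet_eq_cRk, tdSet_eq_cRk]
  apply le_antisymm
  · rw [← Matroid.cRk_closure _ (Units.val '' (Y : Set Kˣ))]
    apply Matroid.cRk_mono
    rw [AlgebraicIndependent.matroid_closure_eq]
    set A := Algebra.adjoin ℚ (Units.val '' (Y : Set Kˣ))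
    have hg : IsAlgebraic A (g : K) := isAlgebraic_adjoin_of_closure _ _ halg
    rintro _ ⟨w, hw, rfl⟩
    obtain ⟨y, hy, z, hz, rfl⟩ := Subgroup.mem_sup.1 hw
    obtain ⟨n, rfl⟩ := Subgroup.mem_zpowers_iff.1 hz
    show IsAlgebraic A _
    rw [Units.val_mul]
    apply IsAlgebraic.mul
    · exact isAlgebraic_algebraMap (⟨y, Algebra.subset_adjoin ⟨y, hy, rfl⟩⟩ : A)
    · rw [Units.val_zpow_eq_zpow_val]
      cases n with
      | ofNat n => simpa using hg.pow n
      | negSucc n => simpa using (hg.pow (n+1)).inv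
  · exact Matroid.cRk_mono _ (Set.image_mono (SetLike.coe_subset_coe.2 le_sup_left))

/-- A subgroup as a submodule over the integers. -/
def toSub (S : Subgroup Kˣ) : Submodule ℤ (Additive Kˣ) :=
  AddSubgroup.toIntSubmodule (Subgroup.toAddSubgroup S)

theorem grpRank_eq (S : Subgroup Kˣ) : grpRank S = Module.rank ℤ (toSub S) := rfl

theorem mem_toSub (S : Subgroup Kˣ) (x : Additive Kˣ) : x ∈ toSub S ↔ x.toMul ∈ S := Iff.rfl

theorem toSub_sup (S : Subgroup Kˣ) (g : Kˣ) :
    toSub (S ⊔ Subgroup.zpowers g) = toSub S ⊔ Submodule.span ℤ {Additive.ofMul g} := by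
  ext x
  rw [mem_toSub, Subgroup.mem_sup, Submodule.mem_sup]
  constructor
  · rintro ⟨y, hy, z, hz, h⟩
    obtain ⟨n, rfl⟩ := Subgroup.mem_zpowers_iff.1 hz
    exact ⟨Additive.ofMul y, hy, _, Submodule.mem_span_singleton.2 ⟨n, rfl⟩, h⟩
  · rintro ⟨y, hy, z, hz, h⟩
    obtain ⟨n, rfl⟩ := Submodule.mem_span_singleton.1 hz
    exact ⟨y.toMul, hy, _, Subgroup.mem_zpowers_iff.2 ⟨n, rfl⟩, h⟩

theorem grpRank_mono {S T : Subgroup Kˣ} (h : S ≤ T) : grpRank S ≤ grpRank T :=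
  Submodule.rank_mono (R := ℤ) (M := Additive Kˣ) (s := toSub S) (t := toSub T) h

theorem finiteRank_sup (Y : Subgroup Kˣ) (g : Kˣ) (h : FiniteRank Y) :
    FiniteRank (Y ⊔ Subgroup.zpowers g) := by
  unfold FiniteRank at *
  rw [grpRank_eq] at *
  rw [toSub_sup]
  refine (Submodule.rank_add_le_rank_add_rank _ _).trans_lt (Cardinal.add_lt_aleph0 h ?_)
  exact (rank_span_le _).trans_lt (by simp)

theorem grpRank_sup (S : Subgroup Kˣ) (g : Kˣ) (h : ∀ n : ℕ, 1 ≤ n → g ^ n ∉ S) :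
    grpRank (S ⊔ Subgroup.zpowers g) = grpRank S + 1 := by
  have hz : ∀ n : ℤ, g ^ n ∈ S → n = 0 := by
    intro n hn
    by_contra h0
    apply h n.natAbs (by omega)
    rcases Int.natAbs_eq n with h1 | h1
    · rw [h1, zpow_natCast] at hn; exact hn
    · rw [h1, zpow_neg, zpow_natCast, inv_mem_iff] at hn; exact hn
  have hinf : toSub S ⊓ Submodule.span ℤ {Additive.ofMul g} = ⊥ := by
    rw [eq_bot_iff]
    rintro x ⟨hx, hx'⟩
    obtain ⟨n, rfl⟩ := Submodule.mem_span_singleton.1 hx'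
    have := hz n hx
    simp [this]
  have hr : Module.rank ℤ (Submodule.span ℤ {Additive.ofMul g}) = 1 := by
    rw [rank_span_set, Cardinal.mk_singleton]
    rw [LinearIndepOn, linearIndependent_iff']
    intro t c hc i hi
    apply hz
    have ht : t = {i} := by
      ext j
      simp [Subsingleton.elim j i, hi]
    rw [ht, Finset.sum_singleton] at hc
    have hi2 : i.1 = Additive.ofMul g := i.2
    have hc2 : g ^ (c i) = 1 := by
      rw [id, hi2] at hc
      exact hc
    rw [hc2]
    exact one_mem S
  have := Submodule.rank_sup_add_rank_inf_eq (toSub S) (Submodule.span ℤ {Additive.ofMul g})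
  rw [hinf, hr, rank_bot, add_zero] at this
  rw [grpRank_eq, grpRank_eq, toSub_sup, this]

/-- A strong set acquires no new green points in its algebraic closure: if `Y` is a
finite-rank strong subgroup of `Kˣ` and `g ∈ G` is algebraic over the subfield of `K`
generated by `Y`, then `g^n ∈ Y` for some `n ≥ 1`. -/
theorem pow_mem_of_green_algebraic {K : Type*} [Field K] [CharZero K] (G Y : Subgroup Kˣ)
    (hfr : FiniteRank Y) (hs : Strong G Y) (g : Kˣ) (hg : g ∈ G)
    (halg : IsAlgebraic (fieldOf Y) (g : K)) :
    ∃ n : ℕ, 1 ≤ n ∧ g ^ n ∈ Y := by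
  by_contra! hcon
  have hle := hs _ (finiteRank_sup Y g hfr) le_sup_left le_top
  unfold delta at hle
  rw [td_sup_eq Y g halg] at hle
  have h1 := grpRank_sup (Y ⊓ G) g fun n hn hmem => hcon n hn hmem.1
  have h2 : grpRank ((Y ⊓ G) ⊔ Subgroup.zpowers g) ≤
      grpRank ((Y ⊔ Subgroup.zpowers g) ⊓ G) :=
    grpRank_mono (sup_le (inf_le_inf_right G le_sup_left)
      (le_inf le_sup_right (Subgroup.zpowers_le.2 hg)))
  have h3 : grpRank ((Y ⊔ Subgroup.zpowers g) ⊓ G) < Cardinal.aleph0 :=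
    (grpRank_mono inf_le_left).trans_lt (finiteRank_sup Y g hfr)
  have h4 : grpRank (Y ⊓ G) < Cardinal.aleph0 := (grpRank_mono inf_le_left).trans_lt hfr
  rw [h1] at h2
  have h5 := Cardinal.toNat_le_toNat h2 h3
  rw [Cardinal.toNat_add h4 Cardinal.one_lt_aleph0, Cardinal.one_toNat] at h5
  omega

end GreenPoints

end
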